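/- Let k be a positive integer and let η be an integer satisfying η² · (2·h_k² − h_{2k}) = 6·h_{2k} + 1 (an equation of rational numbers). If k ≥ 2 then η is not divisible by 5; if k ≥ 8 then η is not divisible by 17; if k ≥ 128 then η is not divisible by 257; and if k ≥ 2^15 then η is not divisible by 65537. -/

import Mathlib

/-- The coefficient `h_m` of `p_m` in the `m`-th Hirzebruch `L`-polynomial:
`h_m = 2^(2m) * (2^(2m-1) - 1) * |B_{2m}| / (2m)!`. -/
noncomputable def hCoeff (m : ℕ) : ℚ :=
  2 ^ (2 * m) * (2 ^ (2 * m - 1) - 1) * |bernoulli (2 * m)| / (Nat.factorial (2 * m) : ℚ)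

theorem padicNorm_abs (p : ℕ) (q : ℚ) : padicNorm p |q| = padicNorm p q := by
  rcases abs_choice q with h | h <;> simp [h]

/-- If `p - 1 ∣ 2k` then `p` divides the denominator of `B_{2k}` exactly once. -/
theorem padicNorm_bernoulli_of_sub_one_dvd {p k : ℕ} [hp : Fact p.Prime] (hk : 0 < k)
    (h : p - 1 ∣ 2 * k) : padicNorm p (bernoulli (2 * k)) = p := by
  obtain ⟨z, hz⟩ := Bernoulli.vonStaudt_clausen k
  have hp1 : (1 : ℚ) < p := mod_cast hp.out.one_lt
  have hmem : p ∈ (Finset.range (2 * k + 2)).filter (fun q => q.Prime ∧ (q - 1) ∣ 2 * k) := by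
    have := Nat.le_of_dvd (by omega) h
    exact Finset.mem_filter.2 ⟨Finset.mem_range.2 (by omega), hp.out, h⟩
  rw [← Finset.add_sum_erase _ _ hmem] at hz
  set R := ∑ q ∈ ((Finset.range (2 * k + 2)).filter
    (fun q => q.Prime ∧ (q - 1) ∣ 2 * k)).erase p, (1 : ℚ) / q
  have hRle : padicNorm p R ≤ 1 := by
    refine padicNorm.sum_le' (fun q hq => ?_) zero_le_one
    obtain ⟨hqp, hq⟩ := Finset.mem_erase.1 hq
    have : Fact q.Prime := ⟨(Finset.mem_filter.1 hq).2.1⟩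
    rw [padicNorm.div, padicNorm.one, padicNorm.padicNorm_of_prime_of_ne (Ne.symm hqp), div_one]
  have hle : padicNorm p ((z : ℚ) - R) ≤ 1 :=
    padicNorm.sub.trans (max_le (padicNorm.of_int z) hRle)
  have hinv : padicNorm p (-(1 / (p : ℚ))) = p := by
    rw [padicNorm.neg, padicNorm.div, padicNorm.one, padicNorm.padicNorm_p_of_prime, one_div,
      inv_inv]
  have hB : bernoulli (2 * k) = ((z : ℚ) - R) + -(1 / (p : ℚ)) := by linarith
  rw [hB, padicNorm.add_eq_max_of_ne (by rw [hinv]; exact (hle.trans_lt hp1).ne), hinv]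
  exact max_eq_right (hle.trans hp1.le)

theorem padicNorm_hCoeff_of_sub_one_dvd {p m : ℕ} [Fact p.Prime] (hm : 0 < m)
    (h : p - 1 ∣ 2 * m) (h2 : ¬ (p : ℤ) ∣ 2 ^ (2 * m - 1) - 1) :
    padicNorm p (hCoeff m) = padicNorm p 2 ^ (2 * m) * p / padicNorm p ((2 * m).factorial : ℚ) := by
  have h1 : padicNorm p ((2 : ℚ) ^ (2 * m - 1) - 1) = 1 := by
    have := (padicNorm.int_eq_one_iff (p := p) _).2 h2
    exact_mod_cast this
  rw [hCoeff, padicNorm.div, padicNorm.mul, padicNorm.mul, h1, padicNorm_abs,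
    padicNorm_bernoulli_of_sub_one_dvd hm h, mul_one]
  congr 2
  exact map_pow (IsAbsoluteValue.toAbsoluteValue (padicNorm p)) 2 (2 * m)

/-- The `2`-adic valuation of `n!` attains its upper bound `n - 1` only at powers of two. -/
theorem eq_two_pow_of_padicValNat_factorial (n : ℕ) (h : padicValNat 2 n.factorial + 1 = n) :
    ∃ a, n = 2 ^ a := by
  induction n using Nat.strong_induction_on with
  | _ n ih =>
    obtain ⟨t, rfl | rfl⟩ := Nat.even_or_odd' n
    · rw [padicValNat_factorial_mul] at h
      obtain ⟨a, ha⟩ := ih t (by omega) (by omega)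
      exact ⟨a + 1, by rw [ha, pow_succ']⟩
    · rw [padicValNat_factorial_mul_add t (by norm_num), padicValNat_factorial_mul] at h
      rcases Nat.eq_zero_or_pos t with rfl | ht
      · exact ⟨0, rfl⟩
      · have := padicValNat_factorial_lt_of_ne_zero 2 ht.ne'
        omega

theorem padicNorm_two_hCoeff_lt_one {m : ℕ} (hm : 0 < m) (h : ∀ a, m ≠ 2 ^ a) :
    padicNorm 2 (hCoeff m) < 1 := by
  have hodd : ¬ ((2 : ℕ) : ℤ) ∣ 2 ^ (2 * m - 1) - 1 := by
    obtain ⟨n, hn⟩ : ∃ n, 2 * m - 1 = n + 1 := ⟨2 * m - 2, by omega⟩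
    rw [hn, pow_succ]
    push_cast
    omega
  have hv : padicValNat 2 (2 * m).factorial + 2 ≤ 2 * m := by
    rw [padicValNat_factorial_mul]
    have h1 := padicValNat_factorial_lt_of_ne_zero 2 hm.ne'
    have h2 : padicValNat 2 m.factorial + 1 ≠ m := fun e =>
      (eq_two_pow_of_padicValNat_factorial m e).elim h
    omega
  have h2 : padicNorm 2 (2 : ℚ) = 2⁻¹ := mod_cast padicNorm.padicNorm_p_of_prime (p := 2)
  have hfac : padicNorm 2 ((2 * m).factorial : ℚ) =
      ((2 : ℚ) ^ padicValNat 2 (2 * m).factorial)⁻¹ := by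
    rw [padicNorm.eq_zpow_of_nonzero (mod_cast Nat.factorial_ne_zero _), padicValRat.of_nat]
    simp
  rw [padicNorm_hCoeff_of_sub_one_dvd hm (by simp) hodd, h2, hfac, inv_pow, div_inv_eq_mul]
  push_cast
  rw [mul_assoc, inv_mul_lt_one₀ (by positivity), ← pow_succ']
  exact pow_lt_pow_right₀ one_lt_two (by omega)

/-- Integrality of `η` at the prime `2` forces `k` to be a power of two. -/
theorem eq_two_pow_of_hCoeff_equation {k : ℕ} (hk : 0 < k) {η : ℤ}
    (hη : (η : ℚ) ^ 2 * (2 * hCoeff k ^ 2 - hCoeff (2 * k)) = 6 * hCoeff (2 * k) + 1) :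
    ∃ a, k = 2 ^ a := by
  by_contra! hpow
  have h1 := padicNorm_two_hCoeff_lt_one hk hpow
  have h2 : padicNorm 2 (hCoeff (2 * k)) < 1 := by
    refine padicNorm_two_hCoeff_lt_one (by omega) fun a ha => ?_
    cases a with
    | zero => omega
    | succ a => exact hpow a (by rw [pow_succ'] at ha; omega)
  have hint (z : ℤ) {x : ℚ} (hx : padicNorm 2 x < 1) : padicNorm 2 (z * x) < 1 := by
    rw [padicNorm.mul]
    exact (mul_le_of_le_one_left (padicNorm.nonneg _) (padicNorm.of_int z)).trans_lt hx
  have hsub {x y : ℚ} (hx : padicNorm 2 x < 1) (hy : padicNorm 2 y < 1) :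
      padicNorm 2 (x - y) < 1 := padicNorm.sub.trans_lt (max_lt hx hy)
  have hsq : padicNorm 2 (hCoeff k * hCoeff k) < 1 := by
    rw [padicNorm.mul]
    exact mul_lt_one_of_nonneg_of_lt_one_left (padicNorm.nonneg _) h1 h1.le
  have key := hsub (hint (η ^ 2) (hsub (hint 2 hsq) h2)) (hint 6 h2)
  have hone : ((η ^ 2 : ℤ) : ℚ) * (((2 : ℤ) : ℚ) * (hCoeff k * hCoeff k) - hCoeff (2 * k)) -
      ((6 : ℤ) : ℚ) * hCoeff (2 * k) = 1 := by
    push_cast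
    linear_combination hη
  rw [hone, padicNorm.one] at key
  exact lt_irrefl _ key

/-- Modulo `2^r + 1`, no odd power of two is congruent to `1`. -/
theorem not_two_pow_add_one_dvd_two_pow_sub_one {r n : ℕ} (hr : 0 < r) (hn : Odd n) :
    ¬ ((2 ^ r + 1 : ℕ) : ℤ) ∣ 2 ^ n - 1 := by
  intro h
  have h1 : ((2 ^ r + 1 : ℕ) : ℤ) ∣ (2 ^ n) ^ r - 1 :=
    h.trans (by simpa using sub_dvd_pow_sub_pow ((2 : ℤ) ^ n) 1 r)
  have h2 : ((2 ^ r + 1 : ℕ) : ℤ) ∣ (2 ^ r) ^ n + 1 := by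
    simpa using hn.add_dvd_pow_add_pow ((2 : ℤ) ^ r) 1
  have h3 := dvd_sub h2 h1
  rw [← pow_mul, ← pow_mul, mul_comm n r, add_sub_sub_cancel] at h3
  have h4 := Int.le_of_dvd (by norm_num) h3
  have h5 : 2 ^ 1 ≤ 2 ^ r := Nat.pow_le_pow_right two_pos hr
  omega

theorem not_dvd_of_hCoeff_equation {p k : ℕ} [hp : Fact p.Prime] (hp3 : 3 < p) (hk : 0 < k)
    (h : p - 1 ∣ 2 * k) (hodd : ∀ n, Odd n → ¬ (p : ℤ) ∣ 2 ^ n - 1) {η : ℤ}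
    (hη : (η : ℚ) ^ 2 * (2 * hCoeff k ^ 2 - hCoeff (2 * k)) = 6 * hCoeff (2 * k) + 1) :
    ¬ (p : ℤ) ∣ η := by
  intro hdvd
  have hp0 : (1 : ℚ) < p := mod_cast hp.out.one_lt
  have n2 : padicNorm p 2 = 1 := by
    have := (padicNorm.nat_eq_one_iff (p := p) 2).2 fun hd => by
      have := Nat.le_of_dvd (by norm_num) hd
      omega
    exact_mod_cast this
  have n3 : padicNorm p 3 = 1 := by
    have := (padicNorm.nat_eq_one_iff (p := p) 3).2 fun hd => by
      have := Nat.le_of_dvd (by norm_num) hd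
      omega
    exact_mod_cast this
  have n6 : padicNorm p 6 = 1 := by
    rw [show (6 : ℚ) = 2 * 3 by norm_num, padicNorm.mul, n2, n3, one_mul]
  have hb := padicNorm_hCoeff_of_sub_one_dvd hk h (hodd _ ⟨k - 1, by omega⟩)
  have ha := padicNorm_hCoeff_of_sub_one_dvd (m := 2 * k) (by omega)
    (h.trans ⟨2, by ring⟩) (hodd _ ⟨2 * k - 1, by omega⟩)
  rw [n2, one_pow, one_mul] at ha hb
  set a := padicNorm p (hCoeff (2 * k))
  set b := padicNorm p (hCoeff k)
  set F := padicNorm p ((2 * (2 * k)).factorial : ℚ) with hF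
  set f := padicNorm p ((2 * k).factorial : ℚ)
  have hFpos : 0 < F := lt_of_le_of_ne (padicNorm.nonneg _)
    (padicNorm.nonzero (mod_cast Nat.factorial_ne_zero _)).symm
  have hfpos : 0 < f := lt_of_le_of_ne (padicNorm.nonneg _)
    (padicNorm.nonzero (mod_cast Nat.factorial_ne_zero _)).symm
  have hF1 : F ≤ 1 := padicNorm.of_nat _
  have hFf : F ≤ f * f := by
    obtain ⟨c, hc⟩ := Nat.factorial_mul_factorial_dvd_factorial_add (2 * k) (2 * k)
    rw [hF, two_mul (2 * k), hc, Nat.cast_mul, Nat.cast_mul, padicNorm.mul, padicNorm.mul]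
    exact mul_le_of_le_one_right (by positivity) (padicNorm.of_nat c)
  have hab : b * b ≤ p * a := by
    rw [ha, hb, div_mul_div_comm, ← mul_div_assoc]
    gcongr
  have ha1 : 1 < a := by
    rw [ha, one_lt_div hFpos]
    exact hF1.trans_lt hp0
  have hright : padicNorm p (6 * hCoeff (2 * k) + 1) = a := by
    have h6 : padicNorm p (6 * hCoeff (2 * k)) = a := by rw [padicNorm.mul, n6, one_mul]
    rw [padicNorm.add_eq_max_of_ne (by rw [h6, padicNorm.one]; exact ha1.ne'), h6, padicNorm.one]
    exact max_eq_left ha1.le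
  have hdiff : padicNorm p (2 * hCoeff k ^ 2 - hCoeff (2 * k)) ≤ p * a := by
    refine padicNorm.sub.trans (max_le ?_ (le_mul_of_one_le_left (by linarith) hp0.le))
    rwa [padicNorm.mul, n2, one_mul, sq, padicNorm.mul]
  have hηn : padicNorm p (η : ℚ) ≤ (p : ℚ)⁻¹ := by
    simpa using (padicNorm.dvd_iff_norm_le (p := p) (n := 1)).1 (by simpa using hdvd)
  have hle : a ≤ (p : ℚ)⁻¹ * (p : ℚ)⁻¹ * (p * a) := by
    have hη0 := padicNorm.nonneg (p := p) (η : ℚ)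
    calc a = padicNorm p (η : ℚ) * padicNorm p (η : ℚ) *
          padicNorm p (2 * hCoeff k ^ 2 - hCoeff (2 * k)) := by
          rw [← hright, ← hη, padicNorm.mul, sq, padicNorm.mul]
      _ ≤ _ := by gcongr; exact padicNorm.nonneg _
  have heq : (p : ℚ)⁻¹ * (p : ℚ)⁻¹ * (p * a) = (p : ℚ)⁻¹ * a := by field_simp
  rw [heq] at hle
  have : (p : ℚ)⁻¹ * a < a := mul_lt_of_lt_one_left (by linarith) (inv_lt_one_of_one_lt₀ hp0)
  linarith

/-- A Fermat prime `2^r + 1 > 3` does not divide `η` as soon as `2^r ≤ 2k`. -/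
theorem not_two_pow_add_one_dvd_of_hCoeff_equation {r k : ℕ} (hp : (2 ^ r + 1).Prime)
    (hr : 2 ≤ r) (hk : 2 ^ r ≤ 2 * k) {η : ℤ}
    (hη : (η : ℚ) ^ 2 * (2 * hCoeff k ^ 2 - hCoeff (2 * k)) = 6 * hCoeff (2 * k) + 1) :
    ¬ ((2 ^ r + 1 : ℕ) : ℤ) ∣ η := by
  have hr4 : 2 ^ 2 ≤ 2 ^ r := Nat.pow_le_pow_right two_pos hr
  have hk0 : 0 < k := by omega
  have : Fact (2 ^ r + 1).Prime := ⟨hp⟩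
  obtain ⟨a, rfl⟩ := eq_two_pow_of_hCoeff_equation hk0 hη
  refine not_dvd_of_hCoeff_equation (by omega) hk0 ?_
    (fun n hn => not_two_pow_add_one_dvd_two_pow_sub_one (by omega) hn) hη
  rw [← pow_succ'] at hk
  rw [Nat.add_sub_cancel, ← pow_succ']
  exact pow_dvd_pow 2 ((Nat.pow_le_pow_iff_right one_lt_two).1 hk)

/-- If `k` is a positive integer and `η` is an integer with
`η² * (2 * h_k² - h_{2k}) = 6 * h_{2k} + 1`, then: `5 ∤ η` if `k ≥ 2`;
`17 ∤ η` if `k ≥ 8`; `257 ∤ η` if `k ≥ 128`; and `65537 ∤ η` if `k ≥ 2^15`. -/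
theorem eta_not_div_fermat_primes (k : ℕ) (hk : 0 < k) (η : ℤ)
    (hη : (η : ℚ) ^ 2 * (2 * hCoeff k ^ 2 - hCoeff (2 * k)) = 6 * hCoeff (2 * k) + 1) :
    (2 ≤ k → ¬ (5 : ℤ) ∣ η) ∧ (8 ≤ k → ¬ (17 : ℤ) ∣ η) ∧
      (128 ≤ k → ¬ (257 : ℤ) ∣ η) ∧ (2 ^ 15 ≤ k → ¬ (65537 : ℤ) ∣ η) := by
  refine ⟨fun h => ?_, fun h => ?_, fun h => ?_, fun h => ?_⟩
  · exact not_two_pow_add_one_dvd_of_hCoeff_equation (r := 2) (by norm_num) (by norm_num)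
      (by omega) hη
  · exact not_two_pow_add_one_dvd_of_hCoeff_equation (r := 4) (by norm_num) (by norm_num)
      (by omega) hη
  · exact not_two_pow_add_one_dvd_of_hCoeff_equation (r := 8) (by norm_num) (by norm_num)
      (by omega) hη
  · exact not_two_pow_add_one_dvd_of_hCoeff_equation (r := 16) (by norm_num) (by norm_num)
      (by omega) hη
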